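/- arXiv:1411.4941 — 5 statements merged into one kernel-verified Lean document; each statement's English description precedes it below -/
import Mathlib

section
/- For each ν > 0 let u_ν be the unique minimizer of J^θ_ν over L²(Ω), and let ū be the unique minimizer of J^θ over the feasible set F = {η ∈ L²(Ω) : Sη(ω) = g_ω for all ω ∈ I}. Then u_ν converges weakly to ū in L²(Ω) as ν → 0⁺. (Theorem 3.3, the control part.) -/
open MeasureTheory Filter
open scoped RealInnerProductSpace Topology

section PenaltyMethod

variable {H K : Type*} [NormedAddCommGroup H] [InnerProductSpace ℝ H]
  [NormedAddCommGroup K] [InnerProductSpace ℝ K]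

/-- The regularised least-squares functional `η ↦ θ/2 ‖Bη - d‖² + 1/2 ‖η‖²`. -/
noncomputable def tikhonov (B : H →L[ℝ] K) (d : K) (θ : ℝ) (η : H) : ℝ :=
  θ / 2 * ‖B η - d‖ ^ 2 + 1 / 2 * ‖η‖ ^ 2

/-- The derivative of `tikhonov B d θ` at `x`, as a linear functional. -/
noncomputable def tikhonovDeriv (B : H →L[ℝ] K) (d : K) (θ : ℝ) (x : H) : H →ₗ[ℝ] ℝ :=
  θ • (innerₛₗ ℝ (B x - d)).comp B.toLinearMap + innerₛₗ ℝ x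

lemma tikhonovDeriv_apply (B : H →L[ℝ] K) (d : K) (θ : ℝ) (x k : H) :
    tikhonovDeriv B d θ x k = θ * ⟪B x - d, B k⟫ + ⟪x, k⟫ := by
  simp [tikhonovDeriv, inner_sub_left]

lemma tikhonov_add (B : H →L[ℝ] K) (d : K) (θ : ℝ) (x k : H) :
    tikhonov B d θ (x + k) = tikhonov B d θ x + tikhonovDeriv B d θ x k +
      (θ / 2 * ‖B k‖ ^ 2 + 1 / 2 * ‖k‖ ^ 2) := by
  have h : B (x + k) - d = (B x - d) + B k := by rw [map_add]; abel
  rw [tikhonovDeriv_apply, tikhonov, tikhonov, h, norm_add_sq_real, norm_add_sq_real]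
  ring

/-- The derivative at a minimiser along a subspace vanishes on that subspace. -/
lemma tikhonovDeriv_eq_zero_of_forall_le {B : H →L[ℝ] K} {d : K} {θ : ℝ} {x k : H}
    (h : ∀ t : ℝ, tikhonov B d θ x ≤ tikhonov B d θ (x + t • k)) :
    tikhonovDeriv B d θ x k = 0 := by
  have hd := discrim_le_zero (a := θ / 2 * ‖B k‖ ^ 2 + 1 / 2 * ‖k‖ ^ 2)
    (b := tikhonovDeriv B d θ x k) (c := 0) fun t => by
      have ht := h t
      rw [tikhonov_add, map_smul, map_smul, norm_smul, norm_smul, mul_pow, mul_pow,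
        Real.norm_eq_abs, sq_abs, smul_eq_mul] at ht
      linarith
  rw [discrim, mul_zero, sub_zero] at hd
  exact pow_eq_zero_iff two_ne_zero |>.mp (le_antisymm hd (sq_nonneg _))

/-- The penalised minimisers approach the constrained minimiser at rate `√ν`. -/
lemma exists_norm_sub_sq_le_of_penalty {α : Type*} [Fintype α] (B : H →L[ℝ] K) (d : K)
    {θ : ℝ} (hθ : 0 ≤ θ) (l : α → H →ₗ[ℝ] ℝ) (g : α → ℝ) {x : H} (hx : ∀ i, l i x = g i)
    (hmin : ∀ η, (∀ i, l i η = g i) → tikhonov B d θ x ≤ tikhonov B d θ η) :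
    ∃ C : ℝ, ∀ ν : ℝ, 0 < ν → ∀ u : H,
      1 / 2 * ∑ i, (l i u - g i) ^ 2 + ν * tikhonov B d θ u ≤ ν * tikhonov B d θ x →
      ‖u - x‖ ^ 2 ≤ ν * C := by
  have hker : ⨅ i, (l i).ker ≤ (tikhonovDeriv B d θ x).ker := fun k hk => by
    simp only [Submodule.mem_iInf, LinearMap.mem_ker] at hk
    exact tikhonovDeriv_eq_zero_of_forall_le fun t => hmin _ fun i => by simp [hk i, hx i]
  obtain ⟨c, hc⟩ := (Submodule.mem_span_range_iff_exists_fun ℝ).mp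
    (mem_span_of_iInf_ker_le_ker hker)
  refine ⟨∑ i, c i ^ 2, fun ν hν u hu => ?_⟩
  have hL : tikhonovDeriv B d θ x (u - x) = ∑ i, c i * (l i u - g i) := by
    simp [← hc, hx]
  have hexp := tikhonov_add B d θ x (u - x)
  rw [add_sub_cancel, hL] at hexp
  have hsq : 0 ≤ ∑ i, (l i u - g i + ν * c i) ^ 2 := Finset.sum_nonneg fun i _ => sq_nonneg _
  have hsum : ∑ i, (l i u - g i + ν * c i) ^ 2 = ∑ i, (l i u - g i) ^ 2 +
      2 * ν * ∑ i, c i * (l i u - g i) + ν ^ 2 * ∑ i, c i ^ 2 := by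
    simp only [Finset.mul_sum, ← Finset.sum_add_distrib]
    exact Finset.sum_congr rfl fun i _ => by ring
  have hB : 0 ≤ ν * (θ / 2 * ‖B (u - x)‖ ^ 2) := by positivity
  rw [hexp] at hu
  refine le_of_mul_le_mul_left ?_ hν
  nlinarith

end PenaltyMethod

/-- Theorem 3.3, the control part: as `ν → 0⁺`, the minimisers `u_ν` of
`J^θ_ν` converge weakly in `L²(Ω)` to the minimiser `ū` of `J^θ` over the feasible set
`F = {η : Sη(ω) = g_ω for all ω ∈ I}`. -/
theorem stmt_6
    {n : ℕ} (Ω : Set (EuclideanSpace ℝ (Fin n)))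
    (hΩo : IsOpen Ω) (hΩb : Bornology.IsBounded Ω)
    (I : Finset Ω) (g : Ω → ℝ) (θ : ℝ) (hθ : 0 ≤ θ)
    (S : Lp ℝ 2 (volume.restrict Ω) →L[ℝ] C(closure Ω, ℝ))
    (ι : C(closure Ω, ℝ) →L[ℝ] Lp ℝ 2 (volume.restrict Ω))
    (hι : ∀ f : C(closure Ω, ℝ), ∀ᵐ x ∂(volume.restrict Ω),
      ∀ hx : x ∈ closure Ω, (ι f) x = f ⟨x, hx⟩)
    (gd : Lp ℝ 2 (volume.restrict Ω))
    (Jθ : Lp ℝ 2 (volume.restrict Ω) → ℝ)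
    (hJθ : ∀ η, Jθ η = θ / 2 * ‖ι (S η) - gd‖ ^ 2 + 1 / 2 * ‖η‖ ^ 2)
    (Jθν : ℝ → Lp ℝ 2 (volume.restrict Ω) → ℝ)
    (hJθν : ∀ ν η, Jθν ν η =
      (1/2) * ∑ ω ∈ I, (S η ⟨ω.1, subset_closure ω.2⟩ - g ω) ^ 2 + ν * Jθ η)
    (F : Set (Lp ℝ 2 (volume.restrict Ω)))
    (hF : F = {η | ∀ ω ∈ I, S η ⟨ω.1, subset_closure ω.2⟩ = g ω})
    (hFne : F.Nonempty)
    (u : ℝ → Lp ℝ 2 (volume.restrict Ω))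
    (hu : ∀ ν : ℝ, 0 < ν → ∀ η, Jθν ν (u ν) ≤ Jθν ν η)
    (ubar : Lp ℝ 2 (volume.restrict Ω))
    (hubarF : ubar ∈ F) (hubar : ∀ η ∈ F, Jθ ubar ≤ Jθ η) :
    ∀ w : Lp ℝ 2 (volume.restrict Ω),
      Tendsto (fun ν : ℝ => ⟪u ν, w⟫) (𝓝[>] 0) (𝓝 ⟪ubar, w⟫) := by
  intro w
  let l : I → Lp ℝ 2 (volume.restrict Ω) →ₗ[ℝ] ℝ := fun ω =>
    (ContinuousMap.evalCLM ℝ ⟨ω.1.1, subset_closure ω.1.2⟩ ∘L S).toLinearMap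
  have hl : ∀ ω η, l ω η = S η ⟨ω.1.1, subset_closure ω.1.2⟩ := fun _ _ => rfl
  obtain rfl : Jθ = tikhonov (ι ∘L S) gd θ := funext hJθ
  subst hF
  obtain ⟨C, hC⟩ := exists_norm_sub_sq_le_of_penalty (ι ∘L S) gd hθ l (fun ω => g ω)
    (x := ubar) (fun ω => hubarF ω ω.2) fun η hη => hubar η fun ω hω => hη ⟨ω, hω⟩
  have hbound : ∀ ν : ℝ, 0 < ν → ‖u ν - ubar‖ ≤ √(ν * C) := fun ν hν => by
    refine Real.le_sqrt_of_sq_le (hC ν hν _ ?_)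
    have h := hu ν hν ubar
    have hzero : ∑ ω ∈ I, (S ubar ⟨ω.1, subset_closure ω.2⟩ - g ω) ^ 2 = 0 :=
      Finset.sum_eq_zero fun ω hω => by rw [hubarF ω hω, sub_self, zero_pow two_ne_zero]
    rw [hJθν, hJθν, hzero, mul_zero, zero_add, ← Finset.sum_coe_sort] at h
    exact h
  have hsqrt : Tendsto (fun ν : ℝ => √(ν * C)) (𝓝[>] 0) (𝓝 0) := by
    have h : Continuous fun ν : ℝ => √(ν * C) := by fun_prop
    simpa using (h.tendsto 0).mono_left nhdsWithin_le_nhds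
  have hlim : Tendsto u (𝓝[>] 0) (𝓝 ubar) :=
    tendsto_iff_norm_sub_tendsto_zero.mpr <| squeeze_zero' (Eventually.of_forall fun _ =>
      norm_nonneg _) (eventually_mem_nhdsWithin.mono hbound) hsqrt
  exact hlim.inner tendsto_const_nhds
end

section
/- Let û ∈ L²(Ω) satisfy Sû(ω) = g_ω for all ω ∈ I, and for ν > 0 let u_ν be a minimizer of J^θ_ν over L²(Ω). Then Σ_{ω∈I} (Su_ν(ω) − g_ω)² ≤ 2ν J^θ(û); consequently Su_ν(ω) → g_ω as ν → 0⁺ for every ω ∈ I. (Step in the proof of Theorem 3.3 showing the limit is feasible for the state-constrained problem.) -/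
open MeasureTheory Filter
open scoped Topology

/-- step in the proof of Theorem 3.3: if `Sû(ω) = g_ω` for all `ω ∈ I`
and `u_ν` minimises `J^θ_ν`, then `Σ_{ω∈I} (Su_ν(ω) − g_ω)² ≤ 2ν J^θ(û)`; consequently
`Su_ν(ω) → g_ω` as `ν → 0⁺` for every `ω ∈ I`. -/
theorem stmt_8
    {n : ℕ} (Ω : Set (EuclideanSpace ℝ (Fin n)))
    (hΩo : IsOpen Ω) (hΩb : Bornology.IsBounded Ω)
    (I : Finset Ω) (g : Ω → ℝ) (θ : ℝ) (hθ : 0 ≤ θ)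
    (S : Lp ℝ 2 (volume.restrict Ω) →L[ℝ] C(closure Ω, ℝ))
    (ι : C(closure Ω, ℝ) →L[ℝ] Lp ℝ 2 (volume.restrict Ω))
    (hι : ∀ f : C(closure Ω, ℝ), ∀ᵐ x ∂(volume.restrict Ω),
      ∀ hx : x ∈ closure Ω, (ι f) x = f ⟨x, hx⟩)
    (gd : Lp ℝ 2 (volume.restrict Ω))
    (Jθ : Lp ℝ 2 (volume.restrict Ω) → ℝ)
    (hJθ : ∀ η, Jθ η = θ / 2 * ‖ι (S η) - gd‖ ^ 2 + 1 / 2 * ‖η‖ ^ 2)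
    (Jθν : ℝ → Lp ℝ 2 (volume.restrict Ω) → ℝ)
    (hJθν : ∀ ν η, Jθν ν η =
      (1/2) * ∑ ω ∈ I, (S η ⟨ω.1, subset_closure ω.2⟩ - g ω) ^ 2 + ν * Jθ η)
    (uhat : Lp ℝ 2 (volume.restrict Ω))
    (huhat : ∀ ω ∈ I, S uhat ⟨ω.1, subset_closure ω.2⟩ = g ω)
    (u : ℝ → Lp ℝ 2 (volume.restrict Ω))
    (hu : ∀ ν : ℝ, 0 < ν → ∀ η, Jθν ν (u ν) ≤ Jθν ν η) :
    (∀ ν : ℝ, 0 < ν →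
      ∑ ω ∈ I, (S (u ν) ⟨ω.1, subset_closure ω.2⟩ - g ω) ^ 2 ≤ 2 * ν * Jθ uhat) ∧
    (∀ ω ∈ I, Tendsto (fun ν : ℝ => S (u ν) ⟨ω.1, subset_closure ω.2⟩)
      (𝓝[>] 0) (𝓝 (g ω))) := by
  have bound : ∀ ν : ℝ, 0 < ν →
      ∑ ω ∈ I, (S (u ν) ⟨ω.1, subset_closure ω.2⟩ - g ω) ^ 2 ≤ 2 * ν * Jθ uhat := by
    intro ν hν
    have hmin := hu ν hν uhat
    have hzero : ∑ ω ∈ I, (S uhat ⟨ω.1, subset_closure ω.2⟩ - g ω) ^ 2 = 0 :=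
      Finset.sum_eq_zero fun ω hω => by rw [huhat ω hω, sub_self, zero_pow two_ne_zero]
    rw [hJθν, hJθν, hzero] at hmin
    have hJ : 0 ≤ Jθ (u ν) := by
      rw [hJθ]
      positivity
    linarith [mul_nonneg hν.le hJ]
  refine ⟨bound, fun ω hω => ?_⟩
  have hlim : Tendsto (fun ν : ℝ => √(2 * ν * Jθ uhat)) (𝓝[>] 0) (𝓝 0) := by
    have hcont : Continuous fun ν : ℝ => √(2 * ν * Jθ uhat) := by fun_prop
    simpa using (hcont.tendsto 0).mono_left nhdsWithin_le_nhds
  rw [tendsto_iff_dist_tendsto_zero]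
  refine squeeze_zero' (Eventually.of_forall fun _ => dist_nonneg) ?_ hlim
  filter_upwards [self_mem_nhdsWithin] with ν hν
  rw [Real.dist_eq]
  refine Real.abs_le_sqrt (le_trans ?_ (bound ν hν))
  exact Finset.single_le_sum
    (f := fun ω : Ω => (S (u ν) ⟨ω.1, subset_closure ω.2⟩ - g ω) ^ 2)
    (fun _ _ => sq_nonneg _) hω
end

section
/- Let u be a minimizer of Ĵ over U_ad and u_h a minimizer of Ĵ_h over U_ad. Then Ĵ(u_h) − Ĵ(u) + Ĵ_h(u) − Ĵ_h(u_h) ≥ ½ Σ_{ω∈I} (Su_h(ω) − Su(ω))² + ½ Σ_{ω∈I} (S_h u(ω) − S_h u_h(ω))² + ν‖u − u_h‖²_{L²(Ω)}; in particular ν‖u − u_h‖²_{L²(Ω)} ≤ |Ĵ(u) − Ĵ_h(u)| + |Ĵ(u_h) − Ĵ_h(u_h)|. (Inequalities (5.12)–(5.14) in the proof of Theorem 5.4.) -/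
open MeasureTheory

/-- If `(1 - t) * q ≤ d` for all `t ∈ (0, 1]`, then `q ≤ d`. -/
theorem le_of_forall_one_sub_mul_le {q d : ℝ}
    (h : ∀ t : ℝ, 0 < t → t ≤ 1 → (1 - t) * q ≤ d) : q ≤ d := by
  by_contra! hlt
  have hd : 0 ≤ d := by simpa using h 1 one_pos le_rfl
  have hq : 0 < q := hd.trans_lt hlt
  have ht := h ((q - d) / (2 * q)) (div_pos (by linarith) (by linarith))
    ((div_le_one (by linarith)).2 (by linarith))
  have hmid : (1 - (q - d) / (2 * q)) * q = (q + d) / 2 := by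
    field_simp
    ring
  linarith

/-- Quadratic growth of a regularized pointwise tracking functional around a minimizer over a
convex set. -/
theorem quadratic_growth_of_isMinOn {E X ι : Type*} [NormedAddCommGroup E] [InnerProductSpace ℝ E]
    [TopologicalSpace X] (s : Finset ι) (p : ι → X) (S : E →L[ℝ] C(X, ℝ))
    (g : ι → ℝ) (ν : ℝ) {J : E → ℝ}
    (hJ : ∀ x, J x = (1/2) * ∑ i ∈ s, (S x (p i) - g i) ^ 2 + ν / 2 * ‖x‖ ^ 2)
    {K : Set E} (hK : Convex ℝ K) {u v : E} (hu : u ∈ K) (hv : v ∈ K)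
    (hmin : ∀ w ∈ K, J u ≤ J w) :
    (1/2) * ∑ i ∈ s, (S v (p i) - S u (p i)) ^ 2 + ν / 2 * ‖u - v‖ ^ 2 ≤ J v - J u := by
  refine le_of_forall_one_sub_mul_le fun t ht0 ht1 => ?_
  have hle := hmin ((1 - t) • u + t • v) (hK hu hv (by linarith) ht0.le (by ring))
  have hnorm : ‖(1 - t) • u + t • v‖ ^ 2 =
      (1 - t) * ‖u‖ ^ 2 + t * ‖v‖ ^ 2 - t * (1 - t) * ‖u - v‖ ^ 2 := by
    rw [norm_add_sq_real, norm_sub_sq_real, norm_smul, norm_smul, mul_pow, mul_pow,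
      real_inner_smul_left, real_inner_smul_right, Real.norm_eq_abs, Real.norm_eq_abs,
      sq_abs, sq_abs]
    ring
  have hsum : ∑ i ∈ s, (S ((1 - t) • u + t • v) (p i) - g i) ^ 2 =
      (1 - t) * ∑ i ∈ s, (S u (p i) - g i) ^ 2 + t * ∑ i ∈ s, (S v (p i) - g i) ^ 2
        - t * (1 - t) * ∑ i ∈ s, (S v (p i) - S u (p i)) ^ 2 := by
    rw [Finset.mul_sum, Finset.mul_sum, Finset.mul_sum, ← Finset.sum_add_distrib,
      ← Finset.sum_sub_distrib]
    refine Finset.sum_congr rfl fun i _ => ?_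
    simp only [map_add, map_smul, ContinuousMap.add_apply, ContinuousMap.smul_apply,
      smul_eq_mul]
    ring
  refine le_of_mul_le_mul_left ?_ ht0
  rw [hJ ((1 - t) • u + t • v), hnorm, hsum] at hle
  rw [hJ u] at hle ⊢
  rw [hJ v]
  linarith

/-- inequalities (5.12)–(5.14) in the proof of Theorem 5.4. -/
theorem stmt_10
    {n : ℕ} (Ω : Set (EuclideanSpace ℝ (Fin n)))
    (hΩo : IsOpen Ω) (hΩb : Bornology.IsBounded Ω)
    (I : Finset Ω) (g : Ω → ℝ) (ν : ℝ) (hν : 0 < ν)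
    (S Sh : Lp ℝ 2 (volume.restrict Ω) →L[ℝ] C(closure Ω, ℝ))
    (Uad : Set (Lp ℝ 2 (volume.restrict Ω)))
    (hUne : Uad.Nonempty) (hUcl : IsClosed Uad) (hUcv : Convex ℝ Uad)
    (Jhat Jhath : Lp ℝ 2 (volume.restrict Ω) → ℝ)
    (hJhat : ∀ η, Jhat η =
      (1/2) * ∑ ω ∈ I, (S η ⟨ω.1, subset_closure ω.2⟩ - g ω) ^ 2 + ν / 2 * ‖η‖ ^ 2)
    (hJhath : ∀ η, Jhath η =
      (1/2) * ∑ ω ∈ I, (Sh η ⟨ω.1, subset_closure ω.2⟩ - g ω) ^ 2 + ν / 2 * ‖η‖ ^ 2)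
    (u uh : Lp ℝ 2 (volume.restrict Ω))
    (huU : u ∈ Uad) (hu : ∀ v ∈ Uad, Jhat u ≤ Jhat v)
    (huhU : uh ∈ Uad) (huh : ∀ v ∈ Uad, Jhath uh ≤ Jhath v) :
    (Jhat uh - Jhat u + (Jhath u - Jhath uh) ≥
      (1/2) * ∑ ω ∈ I,
        (S uh ⟨ω.1, subset_closure ω.2⟩ - S u ⟨ω.1, subset_closure ω.2⟩) ^ 2
      + (1/2) * ∑ ω ∈ I,
        (Sh u ⟨ω.1, subset_closure ω.2⟩ - Sh uh ⟨ω.1, subset_closure ω.2⟩) ^ 2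
      + ν * ‖u - uh‖ ^ 2) ∧
    ν * ‖u - uh‖ ^ 2 ≤ |Jhat u - Jhath u| + |Jhat uh - Jhath uh| := by
  have h₁ := quadratic_growth_of_isMinOn I
    (fun ω => (⟨ω.1, subset_closure ω.2⟩ : closure Ω)) S g ν hJhat hUcv
    huU huhU hu
  have h₂ := quadratic_growth_of_isMinOn I
    (fun ω => (⟨ω.1, subset_closure ω.2⟩ : closure Ω)) Sh g ν hJhath hUcv
    huhU huU huh
  rw [norm_sub_rev uh u] at h₂
  have hS : 0 ≤ ∑ ω ∈ I,
      (S uh ⟨ω.1, subset_closure ω.2⟩ - S u ⟨ω.1, subset_closure ω.2⟩) ^ 2 :=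
    Finset.sum_nonneg fun _ _ => sq_nonneg _
  have hSh : 0 ≤ ∑ ω ∈ I,
      (Sh u ⟨ω.1, subset_closure ω.2⟩ - Sh uh ⟨ω.1, subset_closure ω.2⟩) ^ 2 :=
    Finset.sum_nonneg fun _ _ => sq_nonneg _
  refine ⟨by linarith, ?_⟩
  linarith [neg_abs_le (Jhat u - Jhath u), le_abs_self (Jhat uh - Jhath uh)]
end

section
/- Let u be a minimizer of Ĵ over U_ad and u_h a minimizer of Ĵ_h over U_ad. Then ν‖u − u_h‖²_{L²(Ω)} ≤ ½ ‖Su − S_hu‖_∞ Σ_{ω∈I} ( |Su(ω) − g_ω| + |S_hu(ω) − g_ω| ) + ½ ‖Su_h − S_hu_h‖_∞ Σ_{ω∈I} ( |Su_h(ω) − g_ω| + |S_hu_h(ω) − g_ω| ), where ‖·‖_∞ is the supremum norm on C(Ω̄). (The abstract core of Theorem 5.4; combined with the supremum-norm finite element estimate it yields the O(h^{2−n/2−ε}) error estimate for the control.) -/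
open MeasureTheory

/-- Quadratic growth of a strongly convex function at a minimizer. -/
theorem StrongConvexOn.add_norm_sq_le_of_forall_le {E : Type*} [NormedAddCommGroup E]
    [NormedSpace ℝ E] {s : Set E} {m : ℝ} {f : E → ℝ} (hf : StrongConvexOn s m f) {x y : E}
    (hx : x ∈ s) (hy : y ∈ s) (hmin : ∀ z ∈ s, f x ≤ f z) :
    f x + m / 2 * ‖x - y‖ ^ 2 ≤ f y := by
  have key : ∀ t : ℝ, 0 < t → t < 1 → (1 - t) * (m / 2 * ‖x - y‖ ^ 2) ≤ f y - f x := by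
    intro t ht ht1
    have h1 : 0 ≤ 1 - t := by linarith
    have h2 : 1 - t + t = 1 := by ring
    have h3 := hf.2 hx hy h1 ht.le h2
    have h4 := hmin _ (hf.1 hx hy h1 ht.le h2)
    simp only [smul_eq_mul] at h3
    refine le_of_mul_le_mul_left ?_ ht
    linarith
  have hd : 0 ≤ f y - f x := sub_nonneg.2 (hmin y hy)
  set c := m / 2 * ‖x - y‖ ^ 2
  by_contra! hlt
  have hc : 0 < c := by linarith
  have h := key ((c - (f y - f x)) / (2 * c)) (div_pos (by linarith) (by linarith))
    ((div_lt_one (by linarith)).2 (by linarith))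
  have h5 : (1 - (c - (f y - f x)) / (2 * c)) * c = (c + (f y - f x)) / 2 := by
    field_simp
    ring
  linarith

/-- A Tikhonov-regularized least squares functional is strongly convex. -/
theorem strongConvexOn_sum_sq_add_norm_sq {E ι : Type*} [NormedAddCommGroup E]
    [InnerProductSpace ℝ E] {s : Set E} (hs : Convex ℝ s) (I : Finset ι) (φ : ι → E →ₗ[ℝ] ℝ)
    (g : ι → ℝ) (ν : ℝ) :
    StrongConvexOn s ν fun x ↦ (1 / 2) * ∑ i ∈ I, (φ i x - g i) ^ 2 + ν / 2 * ‖x‖ ^ 2 := by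
  rw [strongConvexOn_iff_convex]
  simp only [add_sub_cancel_right]
  refine ⟨hs, fun x _ y _ a b ha hb hab ↦ ?_⟩
  simp only [smul_eq_mul, Finset.mul_sum, ← Finset.sum_add_distrib]
  refine Finset.sum_le_sum fun i _ ↦ ?_
  obtain rfl : b = 1 - a := by linarith
  simp only [map_add, map_smul, smul_eq_mul]
  nlinarith [mul_nonneg (mul_nonneg ha hb) (sq_nonneg (φ i x - φ i y))]

/-- The difference of two least squares misfits is controlled by a uniform bound on the
difference of the data. -/
theorem half_sum_sq_sub_half_sum_sq_le {ι : Type*} (I : Finset ι) (a b : ι → ℝ) {M : ℝ}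
    (h : ∀ i ∈ I, |a i - b i| ≤ M) :
    (1 / 2) * ∑ i ∈ I, a i ^ 2 - (1 / 2) * ∑ i ∈ I, b i ^ 2 ≤
      (1 / 2) * M * ∑ i ∈ I, (|a i| + |b i|) := by
  rw [← mul_sub, ← Finset.sum_sub_distrib, mul_assoc, Finset.mul_sum I _ M]
  refine mul_le_mul_of_nonneg_left (Finset.sum_le_sum fun i hi ↦ ?_) (by norm_num)
  calc a i ^ 2 - b i ^ 2 ≤ |(a i - b i) * (a i + b i)| := by
        rw [sq_sub_sq, mul_comm]
        exact le_abs_self _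
    _ = |a i - b i| * |a i + b i| := abs_mul _ _
    _ ≤ M * (|a i| + |b i|) :=
        mul_le_mul (h i hi) (abs_add_le _ _) (abs_nonneg _) ((abs_nonneg _).trans (h i hi))

/-- the abstract core of Theorem 5.4: if `u` minimises `Ĵ` and `u_h`
minimises `Ĵ_h` over `U_ad`, then
`ν‖u − u_h‖² ≤ ½‖Su − S_hu‖_∞ Σ_{ω∈I}(|Su(ω) − g_ω| + |S_hu(ω) − g_ω|)
  + ½‖Su_h − S_hu_h‖_∞ Σ_{ω∈I}(|Su_h(ω) − g_ω| + |S_hu_h(ω) − g_ω|)`.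
(Since `Ω` is bounded, `closure Ω` is compact, which we record as an instance so that
`C(closure Ω, ℝ)` carries the supremum norm.) -/
theorem stmt_12
    {n : ℕ} (Ω : Set (EuclideanSpace ℝ (Fin n)))
    (hΩo : IsOpen Ω) (hΩb : Bornology.IsBounded Ω)
    [CompactSpace (closure Ω)]
    (I : Finset Ω) (g : Ω → ℝ) (ν : ℝ) (hν : 0 < ν)
    (S Sh : Lp ℝ 2 (volume.restrict Ω) →L[ℝ] C(closure Ω, ℝ))
    (Uad : Set (Lp ℝ 2 (volume.restrict Ω)))
    (hUne : Uad.Nonempty) (hUcl : IsClosed Uad) (hUcv : Convex ℝ Uad)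
    (Jhat Jhath : Lp ℝ 2 (volume.restrict Ω) → ℝ)
    (hJhat : ∀ η, Jhat η =
      (1/2) * ∑ ω ∈ I, (S η ⟨ω.1, subset_closure ω.2⟩ - g ω) ^ 2 + ν / 2 * ‖η‖ ^ 2)
    (hJhath : ∀ η, Jhath η =
      (1/2) * ∑ ω ∈ I, (Sh η ⟨ω.1, subset_closure ω.2⟩ - g ω) ^ 2 + ν / 2 * ‖η‖ ^ 2)
    (u uh : Lp ℝ 2 (volume.restrict Ω))
    (huU : u ∈ Uad) (hu : ∀ v ∈ Uad, Jhat u ≤ Jhat v)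
    (huhU : uh ∈ Uad) (huh : ∀ v ∈ Uad, Jhath uh ≤ Jhath v) :
    ν * ‖u - uh‖ ^ 2 ≤
      (1/2) * ‖S u - Sh u‖ *
        ∑ ω ∈ I, (|S u ⟨ω.1, subset_closure ω.2⟩ - g ω|
          + |Sh u ⟨ω.1, subset_closure ω.2⟩ - g ω|)
      + (1/2) * ‖S uh - Sh uh‖ *
        ∑ ω ∈ I, (|S uh ⟨ω.1, subset_closure ω.2⟩ - g ω|
          + |Sh uh ⟨ω.1, subset_closure ω.2⟩ - g ω|) := by
  let p : Ω → closure Ω := fun ω ↦ ⟨ω.1, subset_closure ω.2⟩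
  have hconv (T : Lp ℝ 2 (volume.restrict Ω) →L[ℝ] C(closure Ω, ℝ)) :
      StrongConvexOn Uad ν fun η ↦
        (1 / 2) * ∑ ω ∈ I, (T η (p ω) - g ω) ^ 2 + ν / 2 * ‖η‖ ^ 2 :=
    strongConvexOn_sum_sq_add_norm_sq hUcv I
      (fun ω ↦ ((ContinuousMap.evalCLM ℝ (p ω)).comp T).toLinearMap) g ν
  have hJ : StrongConvexOn Uad ν Jhat := by
    rw [funext hJhat]
    exact hconv S
  have hJh : StrongConvexOn Uad ν Jhath := by
    rw [funext hJhath]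
    exact hconv Sh
  have h1 := hJ.add_norm_sq_le_of_forall_le huU huhU hu
  have h2 := hJh.add_norm_sq_le_of_forall_le huhU huU huh
  rw [norm_sub_rev uh u] at h2
  have h3 := half_sum_sq_sub_half_sum_sq_le I (fun ω ↦ Sh u (p ω) - g ω)
    (fun ω ↦ S u (p ω) - g ω) (M := ‖S u - Sh u‖) fun ω _ ↦ by
      rw [sub_sub_sub_cancel_right, abs_sub_comm]
      exact (S u - Sh u).norm_coe_le_norm (p ω)
  have h4 := half_sum_sq_sub_half_sum_sq_le I (fun ω ↦ S uh (p ω) - g ω)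
    (fun ω ↦ Sh uh (p ω) - g ω) (M := ‖S uh - Sh uh‖) fun ω _ ↦ by
      rw [sub_sub_sub_cancel_right]
      exact (S uh - Sh uh).norm_coe_le_norm (p ω)
  simp only [add_comm |Sh u _ - g _|] at h3
  simp only [hJhat, hJhath] at h1 h2
  simp only [p] at h3 h4
  linarith
end

section
/- Let U_σ ⊂ U_ad be nonempty closed convex subsets of L²(Ω), let u minimize Ĵ over U_ad and u_σ minimize Ĵ over U_σ. Then for every w ∈ U_σ, ν‖u − u_σ‖²_{L²(Ω)} + Σ_{ω∈I} (S(u − u_σ)(ω))² ≤ Σ_{ω∈I} (Su_σ(ω) − g_ω)·(S(w − u))(ω) + ν(u_σ, w − u)_{L²(Ω)}. (The key inequality, a reformulation of (5.6) together with the sign identity (p_σ − p, u_σ − u) = Σ_{ω∈I}(S(u − u_σ)(ω))², in the proof of Lemma 5.1.) -/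
open MeasureTheory
open scoped RealInnerProductSpace

section LeastSquares

variable {H ι : Type*} [NormedAddCommGroup H] [InnerProductSpace ℝ H]

/-- First-order optimality condition for a Tikhonov-regularized least-squares functional
minimized over a convex set. -/
theorem leastSquares_variational_inequality (I : Finset ι) (l : ι → H →ₗ[ℝ] ℝ) (g : ι → ℝ)
    (ν : ℝ) (J : H → ℝ)
    (hJ : ∀ η, J η = (1 / 2) * ∑ i ∈ I, (l i η - g i) ^ 2 + ν / 2 * ‖η‖ ^ 2)
    {U : Set H} (hU : Convex ℝ U) {a v : H} (ha : a ∈ U) (hmin : ∀ x ∈ U, J a ≤ J x)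
    (hv : v ∈ U) :
    0 ≤ ∑ i ∈ I, (l i a - g i) * l i (v - a) + ν * ⟪a, v - a⟫ := by
  set d := v - a with hd
  set L := ∑ i ∈ I, (l i a - g i) * l i d + ν * ⟪a, d⟫ with hL
  set Q := ∑ i ∈ I, l i d ^ 2 + ν * ‖d‖ ^ 2 with hQ
  have expand (t : ℝ) : J (a + t • d) = J a + t * L + t ^ 2 / 2 * Q := by
    have hsum : ∑ i ∈ I, (l i (a + t • d) - g i) ^ 2 =
        ∑ i ∈ I, (l i a - g i) ^ 2 + 2 * t * ∑ i ∈ I, (l i a - g i) * l i d +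
          t ^ 2 * ∑ i ∈ I, l i d ^ 2 := by
      simp only [Finset.mul_sum, ← Finset.sum_add_distrib, map_add, map_smul, smul_eq_mul]
      exact Finset.sum_congr rfl fun i _ => by ring
    have hnorm : ‖a + t • d‖ ^ 2 = ‖a‖ ^ 2 + 2 * t * ⟪a, d⟫ + t ^ 2 * ‖d‖ ^ 2 := by
      rw [norm_add_sq_real, inner_smul_right, norm_smul, mul_pow, Real.norm_eq_abs, sq_abs]
      ring
    rw [hJ, hJ, hsum, hnorm, hL, hQ]
    ring
  have slope (t : ℝ) (ht : t ∈ Set.Ioc (0 : ℝ) 1) : 0 ≤ L + t / 2 * Q := by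
    have h := hmin _ (hU.add_smul_sub_mem ha hv ⟨ht.1.le, ht.2⟩)
    rw [← hd, expand] at h
    refine (mul_nonneg_iff_of_pos_left ht.1).mp ?_
    linarith
  have lim : Filter.Tendsto (fun t : ℝ => L + t / 2 * Q) (nhdsWithin 0 (Set.Ioi 0)) (nhds L) := by
    have hcont : Continuous fun t : ℝ => L + t / 2 * Q := by fun_prop
    simpa using (hcont.tendsto 0).mono_left nhdsWithin_le_nhds
  refine ge_of_tendsto lim ?_
  filter_upwards [Ioc_mem_nhdsGT (zero_lt_one (α := ℝ))] with t ht using slope t ht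

/-- Comparison of the minimizers of a Tikhonov-regularized least-squares functional over two
nested convex sets. -/
theorem leastSquares_nested_minimizers (I : Finset ι) (l : ι → H →ₗ[ℝ] ℝ) (g : ι → ℝ)
    (ν : ℝ) (J : H → ℝ)
    (hJ : ∀ η, J η = (1 / 2) * ∑ i ∈ I, (l i η - g i) ^ 2 + ν / 2 * ‖η‖ ^ 2)
    {V U : Set H} (hVU : V ⊆ U) (hV : Convex ℝ V) (hU : Convex ℝ U) {u v w : H}
    (hu : u ∈ U) (humin : ∀ x ∈ U, J u ≤ J x) (hv : v ∈ V) (hvmin : ∀ x ∈ V, J v ≤ J x)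
    (hw : w ∈ V) :
    ν * ‖u - v‖ ^ 2 + ∑ i ∈ I, l i (u - v) ^ 2 ≤
      ∑ i ∈ I, (l i v - g i) * l i (w - u) + ν * ⟪v, w - u⟫ := by
  have h₁ := leastSquares_variational_inequality I l g ν J hJ hU hu humin (hVU hv)
  have h₂ := leastSquares_variational_inequality I l g ν J hJ hV hv hvmin hw
  have hsum : ∑ i ∈ I, l i (u - v) ^ 2 + (∑ i ∈ I, (l i u - g i) * l i (v - u) +
      ∑ i ∈ I, (l i v - g i) * l i (w - v)) = ∑ i ∈ I, (l i v - g i) * l i (w - u) := by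
    simp only [← Finset.sum_add_distrib, map_sub]
    exact Finset.sum_congr rfl fun i _ => by ring
  have hinner : ‖u - v‖ ^ 2 + (⟪u, v - u⟫ + ⟪v, w - v⟫) = ⟪v, w - u⟫ := by
    rw [norm_sub_sq_real]
    simp only [inner_sub_right, real_inner_self_eq_norm_sq, real_inner_comm v u]
    ring
  rw [← hsum, ← hinner]
  linarith

end LeastSquares

/-- the key inequality in the proof of Lemma 5.1, i.e. (5.6) together
with the sign identity `(p_σ − p, u_σ − u) = Σ_{ω∈I}(S(u − u_σ)(ω))²`. -/
theorem stmt_13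
    {n : ℕ} (Ω : Set (EuclideanSpace ℝ (Fin n)))
    (hΩo : IsOpen Ω) (hΩb : Bornology.IsBounded Ω)
    (I : Finset Ω) (g : Ω → ℝ) (ν : ℝ) (hν : 0 < ν)
    (S : Lp ℝ 2 (volume.restrict Ω) →L[ℝ] C(closure Ω, ℝ))
    (Jhat : Lp ℝ 2 (volume.restrict Ω) → ℝ)
    (hJhat : ∀ η, Jhat η =
      (1/2) * ∑ ω ∈ I, (S η ⟨ω.1, subset_closure ω.2⟩ - g ω) ^ 2 + ν / 2 * ‖η‖ ^ 2)
    (Uσ Uad : Set (Lp ℝ 2 (volume.restrict Ω))) (hσsub : Uσ ⊆ Uad)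
    (hUσne : Uσ.Nonempty) (hUσcl : IsClosed Uσ) (hUσcv : Convex ℝ Uσ)
    (hUne : Uad.Nonempty) (hUcl : IsClosed Uad) (hUcv : Convex ℝ Uad)
    (u uσ : Lp ℝ 2 (volume.restrict Ω))
    (huU : u ∈ Uad) (hu : ∀ v ∈ Uad, Jhat u ≤ Jhat v)
    (huσU : uσ ∈ Uσ) (huσ : ∀ v ∈ Uσ, Jhat uσ ≤ Jhat v) :
    ∀ w ∈ Uσ,
      ν * ‖u - uσ‖ ^ 2 + ∑ ω ∈ I, (S (u - uσ) ⟨ω.1, subset_closure ω.2⟩) ^ 2 ≤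
        (∑ ω ∈ I, (S uσ ⟨ω.1, subset_closure ω.2⟩ - g ω) *
          S (w - u) ⟨ω.1, subset_closure ω.2⟩) + ν * ⟪uσ, w - u⟫ := by
  intro w hw
  exact leastSquares_nested_minimizers I
    (fun ω => ((ContinuousMap.evalCLM ℝ
      (⟨ω.1, subset_closure ω.2⟩ : closure Ω)).comp S).toLinearMap)
    g ν Jhat hJhat hσsub hUσcv hUcv huU hu huσU huσ hw
end
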